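/- (Theorem 2.) Let N ≥ 1 be an integer and let x be a nonzero real number. For n ≥ 0, let p_n^{(2N+1)}(x) denote the n-th Taylor coefficient at t = 0 of the map t ↦ (1 - 2tx + t²)^{-(2N+1)/2}. Then for every n ≥ 0, p_n^{(2N+1)}(x) = (1/(2N-1)!!) · Σ_{i=1}^{N} Σ_{m=0}^{n} a_i(N) · C(2N+m-i-1, m) · x^{-(2N+m-i)} · (n-m+i)_i · p_{n-m+i}(x), where p_k is the k-th Legendre polynomial. -/

import Mathlib

/-- The `n`-th Legendre polynomial, given by Rodrigues' formula
`p_n(x) = (1/(2^n n!))·(d/dx)^n [(x²-1)^n]`. -/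
noncomputable def legendreP (n : ℕ) (x : ℝ) : ℝ :=
  (1 / (2 ^ n * (Nat.factorial n : ℝ))) * iteratedDeriv n (fun y : ℝ => (y ^ 2 - 1) ^ n) x

/-- The coefficients `a_i(N)` defined by `a_1(1) = 1`, `a_1(N+1) = (2N-1)·a_1(N)`,
`a_{N+1}(N+1) = a_N(N)`, and `a_i(N+1) = (2N-i)·a_i(N) + a_{i-1}(N)` for `2 ≤ i ≤ N`
(and `a_i(N) = 0` when `i = 0` or `i > N`). -/
def legA : ℕ → ℕ → ℤ
  | _, 0 => 0
  | i, 1 => if i = 1 then 1 else 0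
  | i, (N + 2) => if i = 0 ∨ N + 2 < i then 0
      else (2 * (N + 1) - (i : ℤ)) * legA i (N + 1) + legA (i - 1) (N + 1)


/-! ### Legendre polynomials: Bonnet's recursion from Rodrigues' formula -/

open Polynomial in
theorem iteratedDeriv_poly_aux (p : ℝ[X]) (n : ℕ) (x : ℝ) :
    iteratedDeriv n (fun y : ℝ => p.eval y) x = (derivative^[n] p).eval x := by
  induction n generalizing p with
  | zero => simp
  | succ n ih =>
    rw [iteratedDeriv_succ', Function.iterate_succ_apply, ← ih]
    congr 1
    ext y
    exact p.deriv

open Polynomial in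
/-- `D^k (X^2-1)^m`, evaluated at `x`. -/
noncomputable def legD (k m : ℕ) (x : ℝ) : ℝ :=
  (derivative^[k] ((X ^ 2 - 1 : ℝ[X]) ^ m)).eval x

theorem legendreP_eq (n : ℕ) (x : ℝ) :
    legendreP n x = legD n n x / (2 ^ n * (Nat.factorial n : ℝ)) := by
  unfold legendreP legD
  rw [← iteratedDeriv_poly_aux]
  simp
  ring

open Polynomial in
theorem legD_succ_left (k m : ℕ) (x : ℝ) :
    legD (k + 1) (m + 1) x = 2 * (m + 1) * (x * legD k m x + k * legD (k - 1) m x) := by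
  unfold legD
  rw [Function.iterate_succ_apply]
  have h : derivative ((X ^ 2 - 1 : ℝ[X]) ^ (m + 1))
      = C (2 * (m + 1 : ℝ)) * ((X ^ 2 - 1 : ℝ[X]) ^ m * X) := by
    rw [derivative_pow]
    have h2 : (C 2 : ℝ[X]) = 2 := rfl
    simp [h2]
    ring
  rw [h, iterate_derivative_C_mul, iterate_derivative_mul_X]
  simp only [eval_mul, eval_add, eval_C, eval_X, nsmul_eq_mul, eval_natCast]
  ring

open Polynomial in
theorem legD_succ_right (k m : ℕ) (x : ℝ) :
    legD k (m + 1) x = (x ^ 2 - 1) * legD k m x + 2 * k * x * legD (k - 1) m x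
      + k * (k - 1) * legD (k - 2) m x := by
  unfold legD
  have h : (X ^ 2 - 1 : ℝ[X]) ^ (m + 1)
      = (X ^ 2 - 1 : ℝ[X]) ^ m * X * X - (X ^ 2 - 1 : ℝ[X]) ^ m := by ring
  rw [h, iterate_derivative_sub, iterate_derivative_mul_X, iterate_derivative_mul_X,
    iterate_derivative_mul_X]
  rcases k with _ | k
  · simp
    ring
  · simp
    ring_nf

theorem legD_rel (n : ℕ) (x : ℝ) :
    (n + 2) * legD n (n + 1) x
      = 2 * (n + 1) * ((x ^ 2 - 1) * legD n n x + n * x * legD (n - 1) n x) := by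
  have h1 := legD_succ_right n n x
  rcases n with _ | n
  · simp at h1 ⊢
    linarith
  · have h2 := legD_succ_left n (n + 1) x
    simp only [Nat.add_sub_cancel, show n + 1 - 2 = n - 1 by omega] at h1 ⊢
    push_cast at *
    linear_combination (2 * (n + 2 : ℝ)) * h1 - (n + 1 : ℝ) * h2

theorem legendreP_zero (x : ℝ) : legendreP 0 x = 1 := by
  simp [legendreP]

theorem legendreP_one (x : ℝ) : legendreP 1 x = x := by
  rw [legendreP_eq, legD_succ_left]
  simp [legD]

theorem legendreP_bonnet (n : ℕ) (x : ℝ) :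
    (n + 2) * legendreP (n + 2) x
      = (2 * n + 3) * x * legendreP (n + 1) x - (n + 1) * legendreP n x := by
  rw [legendreP_eq, legendreP_eq, legendreP_eq]
  have h1 := legD_succ_left (n + 1) (n + 1) x
  have h2 := legD_succ_left n n x
  have h3 := legD_rel n x
  simp only [Nat.add_sub_cancel] at h1
  have hf : (Nat.factorial n : ℝ) ≠ 0 := by positivity
  rw [Nat.factorial_succ (n + 1), Nat.factorial_succ n]
  push_cast at *
  have e1 : (n : ℝ) + 1 + 1 ≠ 0 := by positivity
  have e2 : (n : ℝ) + 1 ≠ 0 := by positivity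
  rw [show (2 : ℝ) ^ (n + 2) = 4 * 2 ^ n by ring, show (2 : ℝ) ^ (n + 1) = 2 * 2 ^ n by ring]
  field_simp
  rw [h1]
  have h3' : legD n (n + 1) x
      = 2 * (n + 1) * ((x ^ 2 - 1) * legD n n x + n * x * legD (n - 1) n x) / (n + 2) := by
    rw [← h3]
    field_simp
  rw [h3', h2]
  field_simp
  ring

/-! ### Taylor series -/

open PowerSeries

/-- Formal Taylor series at `0`. -/
noncomputable def taylorS (f : ℝ → ℝ) : PowerSeries ℝ :=
  PowerSeries.mk fun n => iteratedDeriv n f 0 / (Nat.factorial n : ℝ)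

theorem taylorS_congr {f g : ℝ → ℝ} (h : f =ᶠ[nhds 0] g) : taylorS f = taylorS g := by
  ext n
  simp only [taylorS, coeff_mk]
  rw [h.iteratedDeriv_eq]

theorem taylorS_deriv (f : ℝ → ℝ) : taylorS (deriv f) = PowerSeries.derivative ℝ (taylorS f) := by
  ext n
  rw [coeff_derivative]
  simp only [taylorS, coeff_mk]
  rw [iteratedDeriv_succ', Nat.factorial_succ]
  have hf : (Nat.factorial n : ℝ) ≠ 0 := by positivity
  push_cast
  field_simp

theorem taylorS_mul {f g : ℝ → ℝ} (hf : ∀ n : ℕ, ContDiffAt ℝ n f 0)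
    (hg : ∀ n : ℕ, ContDiffAt ℝ n g 0) :
    taylorS (fun t => f t * g t) = taylorS f * taylorS g := by
  ext n
  rw [coeff_mul, Finset.Nat.sum_antidiagonal_eq_sum_range_succ_mk]
  simp only [taylorS, coeff_mk]
  rw [iteratedDeriv_fun_mul (hf n) (hg n), Finset.sum_div]
  refine Finset.sum_congr rfl fun i hi => ?_
  have hi' : i ≤ n := by simpa [Nat.lt_succ_iff] using hi
  rw [Nat.cast_choose ℝ hi']
  have h1 : (Nat.factorial n : ℝ) ≠ 0 := by positivity
  field_simp

theorem taylorS_add {f g : ℝ → ℝ} (hf : ∀ n : ℕ, ContDiffAt ℝ n f 0)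
    (hg : ∀ n : ℕ, ContDiffAt ℝ n g 0) :
    taylorS (fun t => f t + g t) = taylorS f + taylorS g := by
  ext n
  simp only [taylorS, coeff_mk, map_add]
  rw [iteratedDeriv_fun_add (hf n) (hg n), add_div]

theorem taylorS_const (c : ℝ) : taylorS (fun _ => c) = C c := by
  ext n
  simp only [taylorS, coeff_mk, coeff_C, iteratedDeriv_const]
  split_ifs with h
  · simp [h]
  · simp

theorem taylorS_sub (c : ℝ) : taylorS (fun t => c - t) = C c - X := by
  have h1 : (fun t : ℝ => c - t) = fun t => c + (-1) * t := by ext; ring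
  have hid : taylorS (fun t : ℝ => t) = X := by
    ext n
    simp only [taylorS, coeff_mk, coeff_X, iteratedDeriv_fun_id]
    rcases n with _ | _ | n <;> simp
  rw [h1, taylorS_add (fun n => by fun_prop) (fun n => by fun_prop),
    taylorS_mul (fun n => by fun_prop) (fun n => by fun_prop), taylorS_const, taylorS_const, hid]
  simp
  ring

/-- The function `(1-2tx+t²)^(-(2N+1)/2)`. -/
noncomputable def legF (x : ℝ) (N : ℕ) : ℝ → ℝ :=
  fun t : ℝ => (1 - 2 * t * x + t ^ 2) ^ (-(2 * N + 1 : ℝ) / 2)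

theorem legQ_pos (x : ℝ) : ∀ᶠ t : ℝ in nhds 0, 0 < 1 - 2 * t * x + t ^ 2 := by
  have : ContinuousAt (fun t : ℝ => 1 - 2 * t * x + t ^ 2) 0 := by fun_prop
  exact this.eventually (lt_mem_nhds (by simp))

theorem legF_contDiff (x : ℝ) (N : ℕ) (n : ℕ) : ContDiffAt ℝ n (legF x N) 0 := by
  unfold legF
  refine ContDiffAt.rpow_const_of_ne (by fun_prop) (by simp)

theorem legF_deriv (x : ℝ) (N : ℕ) :
    deriv (legF x N) =ᶠ[nhds 0] fun t => (2 * N + 1) * ((x - t) * legF x (N + 1) t) := by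
  filter_upwards [legQ_pos x] with t ht
  have h1 : HasDerivAt (fun t : ℝ => 1 - 2 * t * x + t ^ 2) (-(2 * x) + 2 * t) t := by
    have := (((hasDerivAt_id t).const_mul (2 * x)).const_sub 1).add ((hasDerivAt_id t).pow 2)
    convert! this using 1
    · ext y
      simp
      ring
    · simp
  have h2 := h1.rpow_const (p := -(2 * N + 1 : ℝ) / 2) (Or.inl ht.ne')
  unfold legF
  rw [h2.deriv]
  push_cast
  rw [show (-(2 * (N : ℝ) + 1) / 2 - 1) = (-(2 * ((N : ℝ) + 1) + 1) / 2) by ring]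
  ring

theorem legF_Q (x : ℝ) :
    legF x 0 =ᶠ[nhds 0] fun t => ((x - t) * (x - t) + (1 - x ^ 2)) * legF x 1 t := by
  filter_upwards [legQ_pos x] with t ht
  unfold legF
  rw [show (x - t) * (x - t) + (1 - x ^ 2) = 1 - 2 * t * x + t ^ 2 by ring]
  nth_rewrite 2 [← Real.rpow_one (1 - 2 * t * x + t ^ 2)]
  rw [← Real.rpow_add ht]
  congr 1
  push_cast
  ring

theorem legF_series_deriv (x : ℝ) (N : ℕ) :
    PowerSeries.derivative ℝ (taylorS (legF x N))
      = C (2 * N + 1 : ℝ) * ((C x - X) * taylorS (legF x (N + 1))) := by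
  have h := fun n => legF_contDiff x (N + 1) n
  rw [← taylorS_deriv, taylorS_congr (legF_deriv x N),
    taylorS_mul (fun n => by fun_prop) (fun n => ContDiffAt.mul (by fun_prop) (h n)),
    taylorS_mul (fun n => by fun_prop) h, taylorS_const, taylorS_sub]

theorem legF_series_Q (x : ℝ) :
    taylorS (legF x 0) = ((C x - X) * (C x - X) + C (1 - x ^ 2)) * taylorS (legF x 1) := by
  rw [taylorS_congr (legF_Q x),
    taylorS_mul (fun n => by fun_prop) (legF_contDiff x 1),
    taylorS_add (fun n => by fun_prop) (fun n => by fun_prop),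
    taylorS_mul (fun n => by fun_prop) (fun n => by fun_prop), taylorS_const, taylorS_sub]

/-- The generating function of the Legendre polynomials. -/
theorem coeff_legF_zero (x : ℝ) (n : ℕ) :
    coeff n (taylorS (legF x 0)) = legendreP n x := by
  have h0 : coeff 0 (taylorS (legF x 0)) = 1 := by
    simp [taylorS, legF]
  have hd := legF_series_deriv x 0
  have hQ := legF_series_Q x
  have key : (1 - C (2 * x) * X + X ^ 2) * PowerSeries.derivative ℝ (taylorS (legF x 0))
      = (C x - X) * taylorS (legF x 0) := by
    rw [hd, hQ]
    have h2 : (C 2 : PowerSeries ℝ) = 2 := rfl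
    simp [h2]
    ring
  set G := taylorS (legF x 0) with hG
  have key' : PowerSeries.derivative ℝ G - C (2 * x) * (PowerSeries.derivative ℝ G * X)
      + PowerSeries.derivative ℝ G * X * X = C x * G - G * X := by
    linear_combination key
  have h1 : coeff 1 G = x := by
    have := congrArg (coeff 0) key'
    rw [map_add, map_sub, map_sub, coeff_C_mul, coeff_C_mul, coeff_derivative] at this
    simpa [h0] using this
  induction n using Nat.twoStepInduction with
  | zero => rw [h0, legendreP_zero]
  | one => rw [h1, legendreP_one]
  | more n ih1 ih2 =>
    have := congrArg (coeff (n + 1)) key'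
    rw [map_add, map_sub, map_sub, coeff_C_mul, coeff_C_mul, coeff_succ_mul_X, coeff_succ_mul_X,
      coeff_succ_mul_X] at this
    have hb := legendreP_bonnet n x
    have hn : (n : ℝ) + 2 ≠ 0 := by positivity
    apply mul_left_cancel₀ hn
    rw [hb, ← ih1, ← ih2]
    rcases n with _ | n
    · simp [coeff_derivative] at this ⊢
      linarith
    · rw [coeff_succ_mul_X] at this
      simp only [coeff_derivative] at this
      push_cast at *
      linear_combination this

/-! ### The inverse of `x - X` -/

/-- `1/(x-X)`. -/
noncomputable def legL (x : ℝ) : PowerSeries ℝ := PowerSeries.mk fun m => x⁻¹ ^ (m + 1)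

theorem legL_mul (x : ℝ) (hx : x ≠ 0) : legL x * (C x - X) = 1 := by
  ext n
  rw [mul_sub, map_sub, coeff_mul_C]
  rcases n with _ | n
  · simp [legL, hx]
  · rw [coeff_succ_mul_X]
    simp [legL, coeff_one]
    field_simp
    ring

theorem legL_deriv (x : ℝ) (hx : x ≠ 0) : PowerSeries.derivative ℝ (legL x) = legL x ^ 2 := by
  have h := legL_mul x hx
  have h2 := congrArg (PowerSeries.derivative ℝ) h
  rw [Derivation.leibniz] at h2
  simp at h2
  linear_combination (legL x) * h2 - PowerSeries.derivative ℝ (legL x) * h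

theorem legL_pow_deriv (x : ℝ) (hx : x ≠ 0) (k : ℕ) :
    PowerSeries.derivative ℝ (legL x ^ k) = C (k : ℝ) * legL x ^ (k + 1) := by
  rw [PowerSeries.derivative_pow, legL_deriv x hx]
  rcases k with _ | k
  · simp
  · simp
    ring

theorem coeff_legL_pow (x : ℝ) (k m : ℕ) :
    coeff m (legL x ^ (k + 1)) = (Nat.choose (k + m) m : ℝ) * x⁻¹ ^ (k + 1 + m) := by
  have h : legL x = C x⁻¹ * rescale x⁻¹ (PowerSeries.mk 1) := by
    ext n
    simp [legL, coeff_rescale]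
    ring
  rw [h, mul_pow, ← map_pow, ← map_pow, mk_one_pow_eq_mk_choose_add, coeff_C_mul, coeff_rescale,
    coeff_mk, Nat.choose_symm_add]
  ring

/-! ### The main identity -/

theorem legA_zero (N : ℕ) : legA 0 N = 0 := by
  rcases N with _ | _ | N <;> simp [legA]

theorem legA_gt (N i : ℕ) (h : N < i) : legA i N = 0 := by
  rcases N with _ | _ | N
  · simp [legA]
  · simp [legA]
    omega
  · simp [legA]
    omega

theorem main_series (x : ℝ) (hx : x ≠ 0) (N : ℕ) :
    C (Nat.doubleFactorial (2 * (N + 1) - 1) : ℝ) * taylorS (legF x (N + 1))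
      = ∑ i ∈ Finset.Icc 1 (N + 1), C (legA i (N + 1) : ℝ)
          * (legL x ^ (2 * (N + 1) - i) * (PowerSeries.derivative ℝ)^[i] (taylorS (legF x 0))) := by
  have hL := legL_mul x hx
  induction N with
  | zero =>
    have hd := legF_series_deriv x 0
    simp [legA]
    rw [hd]
    simp
    linear_combination (-taylorS (legF x 1)) * hL
  | succ N ih =>
    set G := taylorS (legF x 0)
    set D := PowerSeries.derivative ℝ
    have hd := legF_series_deriv x (N + 1)
    have h1 := congrArg D ih
    rw [Derivation.leibniz, hd, map_sum] at h1
    have h2 : ∀ i ∈ Finset.Icc 1 (N + 1), D (C (legA i (N + 1) : ℝ)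
          * (legL x ^ (2 * (N + 1) - i) * D^[i] G))
        = C ((2 * (N + 1) - i : ℝ) * legA i (N + 1)) * (legL x ^ (2 * (N + 1) - i + 1) * D^[i] G)
          + C (legA i (N + 1) : ℝ) * (legL x ^ (2 * (N + 1) - i) * D^[i + 1] G) := by
      intro i hi
      have hi' : i ≤ 2 * (N + 1) := by
        have := (Finset.mem_Icc.mp hi).2
        omega
      rw [Derivation.leibniz, Derivation.leibniz, legL_pow_deriv x hx,
        Function.iterate_succ_apply', Nat.cast_sub hi']
      simp [D]
      ring
    rw [Finset.sum_congr rfl h2, Finset.sum_add_distrib] at h1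
    have h3 : ∑ i ∈ Finset.Icc 1 (N + 2), C (legA i (N + 2) : ℝ)
          * (legL x ^ (2 * (N + 2) - i) * D^[i] G)
        = legL x * (∑ i ∈ Finset.Icc 1 (N + 1), C ((2 * (N + 1) - i : ℝ) * legA i (N + 1))
              * (legL x ^ (2 * (N + 1) - i + 1) * D^[i] G))
          + legL x * ∑ i ∈ Finset.Icc 1 (N + 1), C (legA i (N + 1) : ℝ)
              * (legL x ^ (2 * (N + 1) - i) * D^[i + 1] G) := by
      have e1 : ∑ i ∈ Finset.Icc 1 (N + 2), C (legA i (N + 2) : ℝ)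
            * (legL x ^ (2 * (N + 2) - i) * D^[i] G)
          = ∑ i ∈ Finset.Icc 1 (N + 2), (C ((2 * (N + 1) - i : ℝ) * legA i (N + 1))
            * (legL x ^ (2 * (N + 2) - i) * D^[i] G) + C (legA (i - 1) (N + 1) : ℝ)
            * (legL x ^ (2 * (N + 2) - i) * D^[i] G)) := by
        refine Finset.sum_congr rfl fun i hi => ?_
        rw [Finset.mem_Icc] at hi
        rw [legA, if_neg (by omega), ← add_mul, ← map_add]
        push_cast
        rfl
      rw [e1, Finset.sum_add_distrib]
      congr 1
      · rw [Finset.sum_Icc_succ_top (by omega), legA_gt (N + 1) (N + 1 + 1) (by omega)]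
        rw [Finset.mul_sum]
        simp only [Int.cast_zero, mul_zero, map_zero, zero_mul, add_zero]
        refine Finset.sum_congr rfl fun i hi => ?_
        rw [Finset.mem_Icc] at hi
        rw [show 2 * (N + 2) - i = 2 * (N + 1) - i + 1 + 1 by omega, pow_succ _ (_ + 1)]
        ring
      · rw [Finset.mul_sum, ← Finset.Ico_add_one_right_eq_Icc, ← Finset.Ico_add_one_right_eq_Icc,
          Finset.sum_Ico_eq_sum_range, Finset.sum_Ico_eq_sum_range,
          show N + 2 + 1 - 1 = (N + 1 + 1 - 1) + 1 by omega, Finset.sum_range_succ']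
        rw [show (1 + 0 - 1 : ℕ) = 0 from rfl, legA_zero]
        simp only [Nat.add_sub_cancel_left, Int.cast_zero, map_zero, zero_mul, add_zero]
        refine Finset.sum_congr rfl fun i hi => ?_
        rw [Finset.mem_range] at hi
        rw [show 2 * (N + 2) - (1 + (i + 1)) = 2 * (N + 1) - (1 + i) + 1 by omega,
          show 1 + (i + 1) = 1 + i + 1 by omega, show i + 1 = 1 + i by omega]
        ring
    rw [show N + 1 + 1 = N + 2 from rfl] at *
    rw [h3, ← mul_add, ← h1]
    rw [show 2 * (N + 2) - 1 = (2 * (N + 1) - 1) + 2 by omega, Nat.doubleFactorial_add_two]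
    rw [show 2 * (N + 1) - 1 + 2 = 2 * N + 3 by omega]
    simp only [D, derivative_C, smul_eq_mul, mul_zero, add_zero]
    rw [show (((2 * N + 3) * (2 * (N + 1) - 1).doubleFactorial : ℕ) : ℝ)
      = ((2 * (N + 1) - 1).doubleFactorial : ℝ) * (2 * (N + 1 : ℕ) + 1 : ℝ) by push_cast; ring,
      map_mul]
    linear_combination (-C ((2 * (N + 1) - 1).doubleFactorial : ℝ)
      * C (2 * (N + 1 : ℕ) + 1 : ℝ) * taylorS (legF x (N + 2))) * hL

/-- Theorem 2: for `N ≥ 1`, `x ≠ 0` and `n ≥ 0`, the `n`-th Taylor coefficient at `t = 0` of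
`t ↦ (1 - 2tx + t²)^(-(2N+1)/2)` (the higher-order Legendre polynomial `p_n^{(2N+1)}(x)`) equals
`(1/(2N-1)!!) Σ_{i=1}^{N} Σ_{m=0}^{n} a_i(N) C(2N+m-i-1, m) x^{-(2N+m-i)} (n-m+i)_i p_{n-m+i}(x)`. -/
theorem higher_order_legendre_identity (N : ℕ) (hN : 1 ≤ N) (x : ℝ) (hx : x ≠ 0) (n : ℕ) :
    iteratedDeriv n (fun t : ℝ => (1 - 2 * t * x + t ^ 2) ^ (-(2 * N + 1 : ℝ) / 2)) 0
        / (Nat.factorial n : ℝ)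
      = (1 / (Nat.doubleFactorial (2 * N - 1) : ℝ))
          * ∑ i ∈ Finset.Icc 1 N, ∑ m ∈ Finset.range (n + 1),
              (legA i N : ℝ) * (Nat.choose (2 * N + m - i - 1) m : ℝ)
                * x ^ (-(2 * (N : ℤ) + m - i))
                * (Nat.descFactorial (n - m + i) i : ℝ) * legendreP (n - m + i) x := by
  obtain ⟨M, rfl⟩ : ∃ M, N = M + 1 := ⟨N - 1, by omega⟩
  have hm := congrArg (coeff n) (main_series x hx M)
  have hdf : (Nat.doubleFactorial (2 * (M + 1) - 1) : ℝ) ≠ 0 := by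
    have := Nat.doubleFactorial_pos (2 * (M + 1) - 1)
    positivity
  have hT : coeff n (taylorS (legF x (M + 1)))
      = iteratedDeriv n (fun t : ℝ => (1 - 2 * t * x + t ^ 2) ^ (-(2 * (M + 1 : ℕ) + 1 : ℝ) / 2)) 0
        / (Nat.factorial n : ℝ) := by
    simp only [taylorS, coeff_mk]
    rfl
  rw [← hT]
  rw [coeff_C_mul, map_sum] at hm
  rw [one_div, eq_inv_mul_iff_mul_eq₀ hdf, hm]
  refine Finset.sum_congr rfl fun i hi => ?_
  rw [Finset.mem_Icc] at hi
  rw [coeff_C_mul, coeff_mul, Finset.Nat.sum_antidiagonal_eq_sum_range_succ_mk, Finset.mul_sum]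
  refine Finset.sum_congr rfl fun m hm => ?_
  obtain ⟨k, hk⟩ : ∃ k, 2 * (M + 1) - i = k + 1 := ⟨2 * (M + 1) - i - 1, by omega⟩
  simp only [hk]
  rw [coeff_legL_pow, coeff_iterate_derivative, coeff_legF_zero,
    show 2 * (M + 1) + m - i - 1 = k + m by omega]
  have e : -(2 * ((M + 1 : ℕ) : ℤ) + m - i) = -((k + 1 + m : ℕ) : ℤ) := by
    push_cast
    omega
  rw [e, zpow_neg, zpow_natCast, inv_pow]
  rw [Nat.add_descFactorial_eq_ascFactorial]
  ring
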